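/- Let K be a directed poset and let ((C_i), (F_{i-1,i})) be a K-filtered system of categories. (1) If the C_i are additive, the F_{i-1,i} are additive, and each filtration component C_i^k is an additive subcategory of C_i, then the K-filtered inverse limit lim_{K-filtr} C_i is an additive subcategory of lim C_i and each of its filtration components Fil_k is an additive subcategory. (2) If the C_i are abelian, the F_{i-1,i} are exact, and each C_i^k is a Serre subcategory of C_i, then lim_{K-filtr} C_i is an abelian Serre subcategory of lim C_i and each of its filtration components Fil_k is a Serre subcategory. -/

import Mathlib

open CategoryTheory Limits

universe v u v₁ u₁

namespace InvLim

variable {C : ℕ → Type u} [∀ i, Category.{v} (C i)]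

/-- An object of the inverse limit category: a family of objects `obj i ∈ C i` together with
isomorphisms `φ_{i,i+1} : F i (obj (i+1)) ≅ obj i`. -/
structure Obj (F : ∀ i : ℕ, C (i + 1) ⥤ C i) where
  obj : ∀ i, C i
  iso : ∀ i, (F i).obj (obj (i + 1)) ≅ obj i

variable (F : ∀ i : ℕ, C (i + 1) ⥤ C i)

/-- A morphism in the inverse limit category: a family of componentwise morphisms compatible
with the structure isomorphisms. -/
@[ext]
structure Hom (X Y : Obj F) where
  hom : ∀ i, X.obj i ⟶ Y.obj i
  comm : ∀ i, (F i).map (hom (i + 1)) ≫ (Y.iso i).hom = (X.iso i).hom ≫ hom i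

/-- The inverse limit category `lim C_i`. -/
instance : Category (Obj F) where
  Hom X Y := Hom F X Y
  id X := ⟨fun _ => 𝟙 _, fun i => by simp⟩
  comp f g := ⟨fun i => f.hom i ≫ g.hom i, fun i => by
    rw [Functor.map_comp, Category.assoc, g.comm, ← Category.assoc, f.comm, Category.assoc]⟩
  id_comp f := by apply Hom.ext; funext i; exact Category.id_comp _
  comp_id f := by apply Hom.ext; funext i; exact Category.comp_id _
  assoc f g h := by apply Hom.ext; funext i; exact Category.assoc _ _ _

/-- The componentwise morphisms of a morphism in the inverse limit category. -/
def homApp {X Y : Obj F} (f : X ⟶ Y) (i : ℕ) : X.obj i ⟶ Y.obj i :=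
  Hom.hom f i

/-- The projection functor `Pr i : lim C_j ⥤ C i`. -/
def Pr (i : ℕ) : Obj F ⥤ C i where
  obj X := X.obj i
  map f := Hom.hom f i
  map_id _ := rfl
  map_comp _ _ := rfl

end InvLim

namespace InvLim

section Limits

variable {C : ℕ → Type u} [∀ i, Category.{v} (C i)] {F : ∀ i : ℕ, C (i + 1) ⥤ C i}

lemma hom_ext {X Y : Obj F} {f g : X ⟶ Y} (h : ∀ i, (Pr F i).map f = (Pr F i).map g) : f = g :=
  Hom.ext (funext h)

/-- The structure isomorphisms of an object of the inverse limit, expressed with the projection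
functors. -/
def prIso (X : Obj F) (i : ℕ) : (F i).obj ((Pr F (i + 1)).obj X) ≅ (Pr F i).obj X :=
  X.iso i

lemma map_Pr_comm {X Y : Obj F} (f : X ⟶ Y) (i : ℕ) :
    (F i).map ((Pr F (i + 1)).map f) ≫ (prIso Y i).hom = (prIso X i).hom ≫ (Pr F i).map f :=
  Hom.comm f i

/-- A compatible family of componentwise morphisms is a morphism of the inverse limit. -/
def mkHom {X Y : Obj F} (f : ∀ i, (Pr F i).obj X ⟶ (Pr F i).obj Y)
    (h : ∀ i, (F i).map (f (i + 1)) ≫ (prIso Y i).hom = (prIso X i).hom ≫ f i) : X ⟶ Y :=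
  Hom.mk f h

@[simp]
lemma Pr_map_mkHom {X Y : Obj F} (f : ∀ i, (Pr F i).obj X ⟶ (Pr F i).obj Y)
    (h : ∀ i, (F i).map (f (i + 1)) ≫ (prIso Y i).hom = (prIso X i).hom ≫ f i) (i : ℕ) :
    (Pr F i).map (mkHom f h) = f i := rfl

variable (F) in
/-- The structure isomorphisms as a natural isomorphism between projections. -/
def prSuccIso (i : ℕ) : Pr F (i + 1) ⋙ F i ≅ Pr F i :=
  NatIso.ofComponents (fun X => prIso X i) (fun f => map_Pr_comm f i)

lemma isIso_of_Pr {X Y : Obj F} (f : X ⟶ Y) (h : ∀ i, IsIso ((Pr F i).map f)) : IsIso f :=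
  ⟨mkHom (fun i => inv ((Pr F i).map f)) (fun i => by
      rw [Functor.map_inv, IsIso.inv_comp_eq, ← Category.assoc, map_Pr_comm, Category.assoc,
        IsIso.hom_inv_id, Category.comp_id]),
    hom_ext fun i => by simp, hom_ext fun i => by simp⟩

variable {J : Type*} [Category* J]

/-- A cone in the inverse limit category whose projections are limit cones is a limit cone. -/
def isLimitOfPr {D : J ⥤ Obj F} {c : Cone D} (h : ∀ i, IsLimit ((Pr F i).mapCone c)) :
    IsLimit c where
  lift s := mkHom (fun i => (h i).lift ((Pr F i).mapCone s)) fun i => by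
    refine (h i).hom_ext fun j => ?_
    have h₁ := (h (i + 1)).fac ((Pr F (i + 1)).mapCone s) j
    have h₂ := (h i).fac ((Pr F i).mapCone s) j
    dsimp at h₁ h₂ ⊢
    rw [Category.assoc, Category.assoc, h₂, ← map_Pr_comm, ← map_Pr_comm, ← Functor.map_comp_assoc,
      h₁]
  fac s j := hom_ext fun i => by
    simpa using (h i).fac ((Pr F i).mapCone s) j
  uniq s m hm := hom_ext fun i =>
    (h i).uniq ((Pr F i).mapCone s) _ fun j => by
      simp [← hm]

/-- A cocone in the inverse limit category whose projections are colimit cocones is a colimit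
cocone. -/
def isColimitOfPr [∀ i, PreservesColimitsOfShape J (F i)] {D : J ⥤ Obj F} {c : Cocone D}
    (h : ∀ i, IsColimit ((Pr F i).mapCocone c)) : IsColimit c where
  desc s := mkHom (fun i => (h i).desc ((Pr F i).mapCocone s)) fun i => by
    refine (isColimitOfPreserves (F i) (h (i + 1))).hom_ext fun j => ?_
    have h₁ := (h (i + 1)).fac ((Pr F (i + 1)).mapCocone s) j
    have h₂ := (h i).fac ((Pr F i).mapCocone s) j
    dsimp at h₁ h₂ ⊢
    rw [← Functor.map_comp_assoc, h₁, map_Pr_comm, ← Category.assoc, map_Pr_comm,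
      Category.assoc, h₂]
  fac s j := hom_ext fun i => by
    simpa using (h i).fac ((Pr F i).mapCocone s) j
  uniq s m hm := hom_ext fun i =>
    (h i).uniq ((Pr F i).mapCocone s) _ fun j => by
      simp [← hm]

noncomputable section

/-- The componentwise limit of a diagram in the inverse limit category. -/
def limitCone [∀ i, HasLimitsOfShape J (C i)] [∀ i, PreservesLimitsOfShape J (F i)]
    (D : J ⥤ Obj F) : Cone D where
  pt :=
    { obj := fun i => limit (D ⋙ Pr F i)
      iso := fun i => (isLimitOfPreserves (F i)
        (limit.isLimit (D ⋙ Pr F (i + 1)))).conePointsIsoOfNatIso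
          (limit.isLimit (D ⋙ Pr F i)) (Functor.isoWhiskerLeft D (prSuccIso F i)) }
  π :=
    { app := fun j => mkHom (fun i => limit.π (D ⋙ Pr F i) j) fun i =>
        (IsLimit.conePointsIsoOfNatIso_hom_comp (isLimitOfPreserves (F i)
          (limit.isLimit (D ⋙ Pr F (i + 1)))) (limit.isLimit (D ⋙ Pr F i))
          (Functor.isoWhiskerLeft D (prSuccIso F i)) j).symm
      naturality := fun _ _ f => hom_ext fun i =>
        (Category.id_comp _).trans (limit.w (D ⋙ Pr F i) f).symm }

/-- The projections of the componentwise limit are limits. -/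
def isLimitMapLimitCone [∀ i, HasLimitsOfShape J (C i)] [∀ i, PreservesLimitsOfShape J (F i)]
    (D : J ⥤ Obj F) (i : ℕ) : IsLimit ((Pr F i).mapCone (limitCone D)) :=
  IsLimit.ofIsoLimit (limit.isLimit (D ⋙ Pr F i)) (Cone.ext (Iso.refl _) fun _ =>
    (Category.id_comp _).symm)

instance [∀ i, HasLimitsOfShape J (C i)] [∀ i, PreservesLimitsOfShape J (F i)] :
    HasLimitsOfShape J (Obj F) where
  has_limit D := ⟨⟨_, isLimitOfPr (isLimitMapLimitCone D)⟩⟩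

instance [∀ i, HasLimitsOfShape J (C i)] [∀ i, PreservesLimitsOfShape J (F i)] (i : ℕ) :
    PreservesLimitsOfShape J (Pr F i) where
  preservesLimit {D} := preservesLimit_of_preserves_limit_cone
    (isLimitOfPr (isLimitMapLimitCone D)) (isLimitMapLimitCone D i)

/-- The componentwise colimit of a diagram in the inverse limit category. -/
def colimitCocone [∀ i, HasColimitsOfShape J (C i)] [∀ i, PreservesColimitsOfShape J (F i)]
    (D : J ⥤ Obj F) : Cocone D where
  pt :=
    { obj := fun i => colimit (D ⋙ Pr F i)
      iso := fun i => (isColimitOfPreserves (F i)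
        (colimit.isColimit (D ⋙ Pr F (i + 1)))).coconePointsIsoOfNatIso
          (colimit.isColimit (D ⋙ Pr F i)) (Functor.isoWhiskerLeft D (prSuccIso F i)) }
  ι :=
    { app := fun j => mkHom (fun i => colimit.ι (D ⋙ Pr F i) j) fun i =>
        IsColimit.comp_coconePointsIsoOfNatIso_hom (isColimitOfPreserves (F i)
          (colimit.isColimit (D ⋙ Pr F (i + 1)))) (colimit.isColimit (D ⋙ Pr F i))
          (Functor.isoWhiskerLeft D (prSuccIso F i)) j
      naturality := fun _ _ f => hom_ext fun i =>
        (colimit.w (D ⋙ Pr F i) f).trans (Category.comp_id _).symm }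

/-- The projections of the componentwise colimit are colimits. -/
def isColimitMapColimitCocone [∀ i, HasColimitsOfShape J (C i)]
    [∀ i, PreservesColimitsOfShape J (F i)] (D : J ⥤ Obj F) (i : ℕ) :
    IsColimit ((Pr F i).mapCocone (colimitCocone D)) :=
  IsColimit.ofIsoColimit (colimit.isColimit (D ⋙ Pr F i)) (Cocone.ext (Iso.refl _) fun _ =>
    Category.comp_id _)

instance [∀ i, HasColimitsOfShape J (C i)] [∀ i, PreservesColimitsOfShape J (F i)] :
    HasColimitsOfShape J (Obj F) where
  has_colimit D := ⟨⟨_, isColimitOfPr (isColimitMapColimitCocone D)⟩⟩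

instance [∀ i, HasColimitsOfShape J (C i)] [∀ i, PreservesColimitsOfShape J (F i)] (i : ℕ) :
    PreservesColimitsOfShape J (Pr F i) where
  preservesColimit {D} := preservesColimit_of_preserves_colimit_cocone
    (isColimitOfPr (isColimitMapColimitCocone D)) (isColimitMapColimitCocone D i)

end

end Limits

section Additive

variable {C : ℕ → Type u} [∀ i, Category.{v} (C i)] {F : ∀ i : ℕ, C (i + 1) ⥤ C i}
  [∀ i, Preadditive (C i)] [∀ i, (F i).Additive]

instance (X Y : Obj F) : Zero (X ⟶ Y) := ⟨mkHom (fun _ => 0) (by simp)⟩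

instance (X Y : Obj F) : Add (X ⟶ Y) :=
  ⟨fun f g => mkHom (fun i => (Pr F i).map f + (Pr F i).map g) fun i => by
    rw [Functor.map_add, Preadditive.add_comp, Preadditive.comp_add, map_Pr_comm, map_Pr_comm]⟩

instance (X Y : Obj F) : Neg (X ⟶ Y) :=
  ⟨fun f => mkHom (fun i => -(Pr F i).map f) fun i => by
    rw [Functor.map_neg, Preadditive.neg_comp, Preadditive.comp_neg, map_Pr_comm]⟩

lemma Pr_map_zero {X Y : Obj F} (i : ℕ) : (Pr F i).map (0 : X ⟶ Y) = 0 := rfl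

lemma Pr_map_add {X Y : Obj F} (f g : X ⟶ Y) (i : ℕ) :
    (Pr F i).map (f + g) = (Pr F i).map f + (Pr F i).map g := rfl

lemma Pr_map_neg {X Y : Obj F} (f : X ⟶ Y) (i : ℕ) : (Pr F i).map (-f) = -(Pr F i).map f := rfl

instance (X Y : Obj F) : AddCommGroup (X ⟶ Y) where
  add_assoc f g h := hom_ext fun i => by simp only [Pr_map_add, add_assoc]
  zero_add f := hom_ext fun i => by rw [Pr_map_add, Pr_map_zero, zero_add]
  add_zero f := hom_ext fun i => by rw [Pr_map_add, Pr_map_zero, add_zero]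
  neg_add_cancel f := hom_ext fun i => by
    rw [Pr_map_add, Pr_map_neg, Pr_map_zero, neg_add_cancel]
  add_comm f g := hom_ext fun i => by rw [Pr_map_add, Pr_map_add, add_comm]
  nsmul := nsmulRec
  zsmul := zsmulRec

instance : Preadditive (Obj F) where
  add_comp X Y Z f g h := hom_ext fun i => by
    simp only [Functor.map_comp, Pr_map_add, Preadditive.add_comp]
  comp_add X Y Z f g h := hom_ext fun i => by
    simp only [Functor.map_comp, Pr_map_add, Preadditive.comp_add]

instance (i : ℕ) : (Pr F i).Additive where
  map_add := rfl

instance [∀ i, HasFiniteBiproducts (C i)] : HasFiniteBiproducts (Obj F) :=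
  have : HasFiniteProducts (Obj F) := ⟨fun _ => inferInstance⟩
  HasFiniteBiproducts.of_hasFiniteProducts

end Additive

section Abelian

variable {C : ℕ → Type u} [∀ i, Category.{v} (C i)] {F : ∀ i : ℕ, C (i + 1) ⥤ C i}

instance [∀ i, HasFiniteLimits (C i)] [∀ i, PreservesFiniteLimits (F i)] :
    HasFiniteLimits (Obj F) := ⟨fun _ => inferInstance⟩

instance [∀ i, HasFiniteLimits (C i)] [∀ i, PreservesFiniteLimits (F i)] (i : ℕ) :
    PreservesFiniteLimits (Pr F i) := ⟨fun _ => inferInstance⟩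

instance [∀ i, HasFiniteColimits (C i)] [∀ i, PreservesFiniteColimits (F i)] :
    HasFiniteColimits (Obj F) := ⟨fun _ => inferInstance⟩

instance [∀ i, HasFiniteColimits (C i)] [∀ i, PreservesFiniteColimits (F i)] (i : ℕ) :
    PreservesFiniteColimits (Pr F i) := ⟨fun _ => inferInstance⟩

variable [∀ i, Abelian (C i)] [∀ i, PreservesFiniteLimits (F i)]
  [∀ i, PreservesFiniteColimits (F i)]

noncomputable instance : Abelian (Obj F) :=
  have (i : ℕ) : (F i).Additive := Functor.additive_of_preserves_binary_products _
  have {X Y : Obj F} (f : X ⟶ Y) : IsIso (Abelian.coimageImageComparison f) :=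
    isIso_of_Pr _ fun i => by
      rw [Arrow.isIso_iff_isIso_of_isIso
        (Abelian.PreservesCoimageImageComparison.iso (Pr F i) f).hom]
      infer_instance
  Abelian.ofCoimageImageComparisonIsIso

lemma shortExact_map_Pr {S : ShortComplex (Obj F)} (hS : S.ShortExact) (i : ℕ) :
    have : (Pr F i).Additive := Functor.additive_of_preserves_binary_products _
    (S.map (Pr F i)).ShortExact :=
  have : (Pr F i).Additive := Functor.additive_of_preserves_binary_products _
  hS.map_of_exact (Pr F i)

end Abelian

end InvLim

open CategoryTheory Limits InvLim in
/-- Inverse limits of `K`-filtered systems of categories. (1) If the `C_i` are additive, the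
`F_{i-1,i}` are additive, and each filtration component `C_i^k` is an additive subcategory,
then the `K`-filtered inverse limit is an additive subcategory of `lim C_i` (closed under zero
objects and biproducts), and so is each of its filtration components `Fil_k`. (2) If the `C_i`
are abelian, the `F_{i-1,i}` are exact, and each `C_i^k` is a Serre subcategory, then the
`K`-filtered inverse limit is an abelian Serre subcategory of `lim C_i`, and so is each of its
filtration components `Fil_k`. -/
theorem stmt_15 {K : Type u₁} [PartialOrder K] (hdir : ∀ k l : K, ∃ m, k ≤ m ∧ l ≤ m)
    {C : ℕ → Type u} [∀ i, Category.{v} (C i)] (F : ∀ i : ℕ, C (i + 1) ⥤ C i)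
    (P : ∀ i : ℕ, K → C i → Prop)
    (hmono : ∀ (i : ℕ) (k l : K), k ≤ l → ∀ X, P i k X → P i l X)
    (hexh : ∀ (i : ℕ) (X : C i), ∃ k, P i k X)
    (hFfil : ∀ (i : ℕ) (k : K) (X : C (i + 1)), P (i + 1) k X → P i k ((F i).obj X)) :
    (∀ [∀ i, Preadditive (C i)] [∀ i, HasFiniteBiproducts (C i)] [∀ i, (F i).Additive],
      (∀ (i : ℕ) (k : K) (X : C i), IsZero X → P i k X) →
      (∀ (i : ℕ) (k : K),
        letI : HasBinaryBiproducts (C i) := hasBinaryBiproducts_of_finite_biproducts (C i)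
        ∀ X Y Z : C i, P i k X → P i k Y → Nonempty (Z ≅ X ⊞ Y) → P i k Z) →
      ∃ Pre : Preadditive (InvLim.Obj F), letI := Pre;
      ∃ B : HasFiniteBiproducts (InvLim.Obj F), letI := B;
      letI : HasBinaryBiproducts (InvLim.Obj F) := hasBinaryBiproducts_of_finite_biproducts (InvLim.Obj F);
        (∀ k : K,
          (∀ Z : InvLim.Obj F, IsZero Z → ∀ i, P i k (Z.obj i)) ∧
          (∀ X Y Z : InvLim.Obj F, (∀ i, P i k (X.obj i)) → (∀ i, P i k (Y.obj i)) →
            Nonempty (Z ≅ X ⊞ Y) → ∀ i, P i k (Z.obj i))) ∧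
        (∀ Z : InvLim.Obj F, IsZero Z → ∃ k, ∀ i, P i k (Z.obj i)) ∧
        (∀ X Y Z : InvLim.Obj F, (∃ k, ∀ i, P i k (X.obj i)) → (∃ k, ∀ i, P i k (Y.obj i)) →
          Nonempty (Z ≅ X ⊞ Y) → ∃ k, ∀ i, P i k (Z.obj i))) ∧
    (∀ [∀ i, Abelian (C i)] [∀ i, PreservesFiniteLimits (F i)]
        [∀ i, PreservesFiniteColimits (F i)],
      (∀ (i : ℕ) (k : K) (S : ShortComplex (C i)), S.ShortExact →
        (P i k S.X₂ ↔ P i k S.X₁ ∧ P i k S.X₃)) →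
      ∃ Ab : Abelian (InvLim.Obj F), letI := Ab;
        (∀ (k : K) (S : ShortComplex (InvLim.Obj F)), S.ShortExact →
          ((∀ i, P i k (S.X₂.obj i)) ↔ (∀ i, P i k (S.X₁.obj i)) ∧ (∀ i, P i k (S.X₃.obj i)))) ∧
        (∀ S : ShortComplex (InvLim.Obj F), S.ShortExact →
          ((∃ k, ∀ i, P i k (S.X₂.obj i)) ↔
            (∃ k, ∀ i, P i k (S.X₁.obj i)) ∧ (∃ k, ∀ i, P i k (S.X₃.obj i))))) := by
  have hdir₂ {X Y : InvLim.Obj F} (hX : ∃ k, ∀ i, P i k (X.obj i))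
      (hY : ∃ k, ∀ i, P i k (Y.obj i)) :
      ∃ k, (∀ i, P i k (X.obj i)) ∧ ∀ i, P i k (Y.obj i) := by
    obtain ⟨k, hk⟩ := hX
    obtain ⟨l, hl⟩ := hY
    obtain ⟨m, hkm, hlm⟩ := hdir k l
    exact ⟨m, fun i => hmono i k m hkm _ (hk i), fun i => hmono i l m hlm _ (hl i)⟩
  constructor
  · intro _ _ _ hzero hbiprod
    have hz (k : K) (Z : InvLim.Obj F) (hZ : IsZero Z) (i : ℕ) : P i k (Z.obj i) :=
      hzero i k _ ((Pr F i).map_isZero hZ)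
    let : HasBinaryBiproducts (InvLim.Obj F) := hasBinaryBiproducts_of_finite_biproducts _
    let (i : ℕ) : HasBinaryBiproducts (C i) := hasBinaryBiproducts_of_finite_biproducts (C i)
    have (i : ℕ) (X Y : InvLim.Obj F) : PreservesBinaryBiproduct X Y (Pr F i) :=
      (preservesBinaryBiproducts_of_preservesBiproducts (Pr F i)).preserves
    have hb (k : K) (X Y Z : InvLim.Obj F) (hX : ∀ i, P i k (X.obj i))
        (hY : ∀ i, P i k (Y.obj i)) (e : Nonempty (Z ≅ X ⊞ Y)) (i : ℕ) : P i k (Z.obj i) :=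
      hbiprod i k _ _ _ (hX i) (hY i)
        (e.map fun e => (Pr F i).mapIso e ≪≫ (Pr F i).mapBiprod X Y)
    refine ⟨inferInstance, inferInstance, fun k => ⟨hz k, hb k⟩, fun Z hZ => ?_,
      fun X Y Z hX hY e => ?_⟩
    · obtain ⟨k, -⟩ := hexh 0 (Z.obj 0)
      exact ⟨k, hz k Z hZ⟩
    · obtain ⟨k, hX, hY⟩ := hdir₂ hX hY
      exact ⟨k, hb k X Y Z hX hY e⟩
  · intro _ _ _ hserre
    have hs (k : K) (S : ShortComplex (InvLim.Obj F)) (hS : S.ShortExact) :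
        (∀ i, P i k (S.X₂.obj i)) ↔ (∀ i, P i k (S.X₁.obj i)) ∧ ∀ i, P i k (S.X₃.obj i) := by
      rw [← forall_and]
      exact forall_congr' fun i => hserre i k _ (shortExact_map_Pr hS i)
    refine ⟨inferInstance, hs, fun S hS => ⟨?_, fun ⟨h₁, h₃⟩ => ?_⟩⟩
    · rintro ⟨k, hk⟩
      exact ⟨⟨k, ((hs k S hS).1 hk).1⟩, ⟨k, ((hs k S hS).1 hk).2⟩⟩
    · obtain ⟨k, h⟩ := hdir₂ h₁ h₃
      exact ⟨k, (hs k S hS).2 h⟩
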